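/- Let Λ = Z_p⟦T⟧ and let M be a finitely generated torsion Λ-module which is finitely generated over Z_p (i.e., μ(M) = 0), of Z_p-rank λ. For each n let ω_n = (1+T)^{p^n} − 1 and assume M/ω_n M is finite for all n. Then there exist an integer n_0 and a constant ν such that ord_p(#(M/ω_n M)) = λ n + ν for all n ≥ n_0. -/

import Mathlib

namespace Iw

variable (p : ℕ) [Fact p.Prime] (M : Type) [AddCommGroup M]
    [Module (PowerSeries ℤ_[p]) M]

/-- `a M` as a submodule. -/
noncomputable abbrev D (a : PowerSeries ℤ_[p]) : Submodule (PowerSeries ℤ_[p]) M :=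
  LinearMap.range (a • (LinearMap.id : M →ₗ[PowerSeries ℤ_[p]] M))

/-- `ω_n`. -/
noncomputable abbrev om (n : ℕ) : PowerSeries ℤ_[p] :=
  (1 + PowerSeries.X : PowerSeries ℤ_[p]) ^ (p ^ n) - 1

lemma mem_D (a : PowerSeries ℤ_[p]) (x : M) : x ∈ D p M a ↔ ∃ y, a • y = x := by
  simp [D]

lemma p_mem : (p : PowerSeries ℤ_[p]) ∈ IsLocalRing.maximalIdeal (PowerSeries ℤ_[p]) := by
  rw [IsLocalRing.mem_maximalIdeal, mem_nonunits_iff, PowerSeries.isUnit_iff_constantCoeff]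
  simp only [map_natCast]
  exact PadicInt.prime_p.not_isUnit

lemma X_mem : (PowerSeries.X : PowerSeries ℤ_[p]) ∈
    IsLocalRing.maximalIdeal (PowerSeries ℤ_[p]) := by
  rw [IsLocalRing.mem_maximalIdeal, mem_nonunits_iff, PowerSeries.isUnit_iff_constantCoeff]
  simp

lemma om_succ (n : ℕ) : ∃ c : PowerSeries ℤ_[p], om p (n + 1) = om p n * (p + om p n * c) := by
  have h1 : ∀ i : ℕ, ∃ c : PowerSeries ℤ_[p],
      (1 + om p n) ^ i = 1 + om p n * c := by
    intro i
    obtain ⟨c, hc⟩ := sub_one_dvd_pow_sub_one (1 + om p n) i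
    exact ⟨c, by rw [add_sub_cancel_left] at hc; linear_combination hc⟩
  choose c hc using h1
  refine ⟨∑ i ∈ Finset.range p, c i, ?_⟩
  have h2 := geom_sum_mul (1 + om p n) p
  simp only [hc, Finset.sum_add_distrib, ← Finset.mul_sum, Finset.sum_const, Finset.card_range,
    nsmul_eq_mul, mul_one] at h2
  rw [← hc] at h2
  have h3 : om p (n + 1) = (1 + om p n) ^ p - 1 := by
    simp only [om]; rw [add_sub_cancel, ← pow_mul, pow_succ]
  rw [h3, ← h2]; ring

lemma om_mem (n : ℕ) : om p n ∈ IsLocalRing.maximalIdeal (PowerSeries ℤ_[p]) ^ (n + 1) := by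
  induction n with
  | zero => simpa [om] using X_mem p
  | succ n ih =>
    obtain ⟨c, hc⟩ := om_succ p n
    rw [hc, pow_succ]
    refine Ideal.mul_mem_mul ih (add_mem (p_mem p) (Ideal.mul_mem_right _ _ ?_))
    exact Ideal.pow_le_self (by omega) ih

variable [Module ℤ_[p] M] [IsScalarTower ℤ_[p] (PowerSeries ℤ_[p]) M]

lemma p_smul (s : ℕ) (x : M) :
    (p ^ s : PowerSeries ℤ_[p]) • x = (p ^ s : ℤ_[p]) • x := by
  have h := smul_assoc (p ^ s : ℤ_[p]) (1 : PowerSeries ℤ_[p]) x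
  rw [one_smul] at h
  rw [← h, Algebra.smul_def]
  simp

variable [Module.Finite (PowerSeries ℤ_[p]) M] [Module.Finite ℤ_[p] M]

lemma finite_padic (s : ℕ) : Finite (ℤ_[p] ⧸ Ideal.span {(p ^ s : ℤ_[p])}) := by
  rw [← PadicInt.ker_toZModPow]
  have : NeZero (p ^ s) := ⟨pow_ne_zero _ (Fact.out : p.Prime).ne_zero⟩
  exact Finite.of_injective _ (RingHom.kerLift_injective (PadicInt.toZModPow (p := p) s))

lemma finite_Q (s : ℕ) : Finite (M ⧸ D p M (p ^ s)) := by
  have := finite_padic p s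
  have h := Submodule.finite_quotient_smul (Ideal.span {(p ^ s : ℤ_[p])})
    (N := (⊤ : Submodule ℤ_[p] M)) Module.Finite.fg_top
  have e : (D p M (p ^ s)).toAddSubgroup =
      (Ideal.span {(p ^ s : ℤ_[p])} • (⊤ : Submodule ℤ_[p] M)).toAddSubgroup := by
    ext x
    simp only [Submodule.mem_toAddSubgroup, mem_D, p_smul]
    rw [Submodule.ideal_span_singleton_smul, Submodule.mem_smul_pointwise_iff_exists]
    simp
  change Finite (M ⧸ (D p M (p ^ s)).toAddSubgroup)
  rw [e]; exact h

lemma exists_k (s : ℕ) : ∃ k : ℕ, ∀ n, k ≤ n → D p M (om p n) ≤ D p M (p ^ s) := by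
  have := finite_Q p M s
  set Q := M ⧸ D p M (p ^ s)
  set m := IsLocalRing.maximalIdeal (PowerSeries ℤ_[p])
  let f : ℕ →o (Submodule (PowerSeries ℤ_[p]) Q)ᵒᵈ :=
    ⟨fun k => OrderDual.toDual (m ^ k • ⊤), fun i j h =>
      Submodule.smul_mono_left (Ideal.pow_le_pow_right h)⟩
  obtain ⟨k, hk⟩ := IsArtinian.monotone_stabilizes f
  have h1 : m ^ k • (⊤ : Submodule (PowerSeries ℤ_[p]) Q) = m ^ (k + 1) • ⊤ := hk (k + 1) (by omega)
  have h2 : m ^ k • (⊤ : Submodule (PowerSeries ℤ_[p]) Q) = ⊥ := by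
    refine Submodule.eq_bot_of_le_smul_of_le_jacobson_bot m _ (IsNoetherian.noetherian _) ?_
      (IsLocalRing.maximalIdeal_le_jacobson _)
    rw [← mul_smul, ← pow_succ', ← h1]
  refine ⟨k, fun n hn x hx => ?_⟩
  obtain ⟨y, rfl⟩ := (mem_D ..).1 hx
  rw [← Submodule.Quotient.mk_eq_zero, Submodule.Quotient.mk_smul, ← Submodule.mem_bot (PowerSeries ℤ_[p]), ← h2]
  exact Submodule.smul_mem_smul (Ideal.pow_le_pow_right (by omega) (om_mem p n)) trivial

lemma D_succ (n : ℕ) (h : D p M (om p n) ≤ D p M (p ^ 2)) (x : M) :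
    x ∈ D p M (om p (n + 1)) ↔ ∃ y ∈ D p M (om p n), x = (p : ℤ_[p]) • y := by
  have hp := p_smul p M 1
  simp only [pow_one] at hp
  obtain ⟨c, hc⟩ := om_succ p n
  set ν : PowerSeries ℤ_[p] := p + om p n * c
  have hω : ∀ y : M, ∃ z : M, (om p n * c) • y = (p ^ 2 : PowerSeries ℤ_[p]) • z := by
    intro y
    obtain ⟨z, hz⟩ := (mem_D ..).1 (h ((mem_D ..).2 ⟨c • y, rfl⟩))
    exact ⟨z, by rw [mul_smul, hz]⟩
  have hle : D p M p ≤ D p M ν := by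
    refine Submodule.le_of_le_smul_of_le_jacobson_bot
      (I := IsLocalRing.maximalIdeal (PowerSeries ℤ_[p])) ?_
      (IsLocalRing.maximalIdeal_le_jacobson _) ?_
    · rw [D, LinearMap.range_eq_map]; exact Module.Finite.fg_top.map _
    · intro x hx
      obtain ⟨y, rfl⟩ := (mem_D ..).1 hx
      obtain ⟨z, hz⟩ := hω y
      have : (p : PowerSeries ℤ_[p]) • y = ν • y + (p : PowerSeries ℤ_[p]) • (p : PowerSeries ℤ_[p]) • (-z) := by
        rw [add_smul, hz, smul_smul, ← pow_two, smul_neg]; abel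
      rw [this]
      exact Submodule.add_mem_sup ((mem_D ..).2 ⟨y, rfl⟩)
        (Submodule.smul_mem_smul (p_mem p) ((mem_D ..).2 ⟨_, rfl⟩))
  constructor
  · intro hx
    obtain ⟨y, rfl⟩ := (mem_D ..).1 hx
    obtain ⟨z, hz⟩ := hω y
    refine ⟨om p n • (y + (p : PowerSeries ℤ_[p]) • z), (mem_D ..).2 ⟨_, rfl⟩, ?_⟩
    rw [← hp, hc, mul_smul, smul_comm (p : PowerSeries ℤ_[p]), add_smul, hz, smul_add (p : PowerSeries ℤ_[p]), smul_smul (p : PowerSeries ℤ_[p]) (p : PowerSeries ℤ_[p]), pow_two]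
  · rintro ⟨y, hy, rfl⟩
    obtain ⟨y, rfl⟩ := (mem_D ..).1 hy
    obtain ⟨z, hz⟩ := (mem_D ..).1 (hle ((mem_D ..).2 ⟨y, rfl⟩))
    refine (mem_D ..).2 ⟨z, ?_⟩
    rw [← hp, hc, mul_smul, hz, smul_comm]

lemma exists_s : ∃ s : ℕ, ∀ x ∈ Submodule.torsion ℤ_[p] M, (p ^ s : ℤ_[p]) • x = 0 := by
  have h1 : ∀ x ∈ Submodule.torsion ℤ_[p] M, ∃ s : ℕ, (p ^ s : ℤ_[p]) • x = 0 := by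
    rintro x ⟨a, ha⟩
    have ha0 : (a : ℤ_[p]) ≠ 0 := nonZeroDivisors.coe_ne_zero a
    refine ⟨(a : ℤ_[p]).valuation, ?_⟩
    have h2 : (a : ℤ_[p]) • x = 0 := ha
    rw [PadicInt.unitCoeff_spec ha0, mul_smul] at h2
    exact (PadicInt.unitCoeff ha0).isUnit.smul_eq_zero.1 h2
  obtain ⟨S, hS⟩ := (IsNoetherian.noetherian (Submodule.torsion ℤ_[p] M) : (Submodule.torsion ℤ_[p] M).FG)
  choose! t ht using h1
  refine ⟨S.sup t, fun x hx => ?_⟩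
  rw [← hS] at hx
  have h0 : ∀ y ∈ S, (p ^ (S.sup t) : ℤ_[p]) • y = 0 := fun y hy => by
    rw [← Nat.sub_add_cancel (Finset.le_sup (f := t) hy), pow_add, mul_smul,
      ht y (hS ▸ Submodule.subset_span hy), smul_zero]
  have : Submodule.span ℤ_[p] (S : Set M) ≤ LinearMap.ker (LinearMap.lsmul ℤ_[p] M (p ^ (S.sup t))) :=
    Submodule.span_le.2 fun y hy => h0 y hy
  exact this hx

/-- index of `pN` in a free module -/
lemma relIndex_p (N : Type) [AddCommGroup N] [Module ℤ_[p] N] [Module.Finite ℤ_[p] N]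
    [Module.Free ℤ_[p] N] (H : AddSubgroup N) (hH : ∀ x, x ∈ H ↔ ∃ y : N, x = (p : ℤ_[p]) • y) :
    H.index = p ^ Module.finrank ℤ_[p] N := by
  let b := Module.finBasis ℤ_[p] N
  let g : N →+ (Fin (Module.finrank ℤ_[p] N) → ZMod p) :=
    ((PadicInt.toZMod (p := p)).toAddMonoidHom.compLeft _).comp
      b.equivFun.toLinearMap.toAddMonoidHom
  have hg : ∀ x i, g x i = PadicInt.toZMod (b.equivFun x i) := fun x i => rfl
  have hker : g.ker = H := by
    ext x
    rw [AddMonoidHom.mem_ker, hH]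
    constructor
    · intro h
      have h1 : ∀ i, ∃ c, b.equivFun x i = p * c := by
        intro i
        have : PadicInt.toZMod (b.equivFun x i) = 0 := by rw [← hg, h]; rfl
        rw [← RingHom.mem_ker, PadicInt.ker_toZMod, PadicInt.maximalIdeal_eq_span_p,
          Ideal.mem_span_singleton] at this
        exact this
      choose c hc using h1
      refine ⟨b.equivFun.symm c, ?_⟩
      apply b.equivFun.injective
      rw [map_smul, LinearEquiv.apply_symm_apply]
      ext1 i
      simp [hc]
    · rintro ⟨y, rfl⟩
      ext1 i
      rw [hg, map_smul]
      simp
  have hs : Function.Surjective g := by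
    intro v
    choose w hw using fun i => ZMod.ringHom_surjective (PadicInt.toZMod (p := p)) (v i)
    refine ⟨b.equivFun.symm w, ?_⟩
    ext1 i
    rw [hg, LinearEquiv.apply_symm_apply, hw]
  rw [← hker, AddSubgroup.index_ker, AddMonoidHom.range_eq_top.2 hs]
  simp

lemma card_succ (n s : ℕ) (hs : 2 ≤ s)
    (hst : ∀ x ∈ Submodule.torsion ℤ_[p] M, (p ^ s : ℤ_[p]) • x = 0)
    (h : D p M (om p n) ≤ D p M (p ^ s)) (hf : Finite (M ⧸ D p M (om p n))) :
    Nat.card (M ⧸ D p M (om p (n + 1))) =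
      p ^ (Module.finrank ℤ_[p] (M ⧸ Submodule.torsion ℤ_[p] M)) *
        Nat.card (M ⧸ D p M (om p n)) := by
  have hp0 : (p : ℤ_[p]) ≠ 0 := PadicInt.prime_p.ne_zero
  have hsucc := D_succ p M n (h.trans (by
    intro x hx
    obtain ⟨y, rfl⟩ := (mem_D ..).1 hx
    refine (mem_D ..).2 ⟨(p ^ (s - 2) : PowerSeries ℤ_[p]) • y, ?_⟩
    rw [smul_smul, ← pow_add]; congr 2; omega))
  let N : Submodule ℤ_[p] M := (D p M (om p n)).restrictScalars ℤ_[p]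
  have htf : Submodule.torsion ℤ_[p] N = ⊥ := by
    rw [eq_bot_iff]
    rintro ⟨x, hx⟩ ⟨a, ha⟩
    have ha' : (a : ℤ_[p]) • x = 0 := congrArg Subtype.val ha
    obtain ⟨y, rfl⟩ := (mem_D ..).1 (h hx)
    rw [p_smul, smul_smul] at ha'
    have hy : y ∈ Submodule.torsion ℤ_[p] M :=
      ⟨a * ⟨(p : ℤ_[p]) ^ s, mem_nonZeroDivisors_of_ne_zero (pow_ne_zero _ hp0)⟩, ha'⟩
    simp only [Submodule.mem_bot, Submodule.mk_eq_zero]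
    rw [p_smul, hst y hy]
  have : Module.IsTorsionFree ℤ_[p] N := by
    exact Submodule.isTorsionFree_iff_torsion_eq_bot.2 htf
  have hfr : Module.finrank ℤ_[p] N =
      Module.finrank ℤ_[p] (M ⧸ Submodule.torsion ℤ_[p] M) := by
    have e1 := Submodule.finrank_quotient_add_finrank N
    have e2 := Submodule.finrank_quotient_add_finrank (Submodule.torsion ℤ_[p] M)
    have t1 : Module.finrank ℤ_[p] (Submodule.torsion ℤ_[p] M) = 0 := by
      rw [Module.finrank_eq_zero_iff_isTorsion]
      exact Submodule.torsion_isTorsion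
    have t2 : Module.finrank ℤ_[p] (M ⧸ N) = 0 := by
      rw [Module.finrank_eq_zero_iff_isTorsion]
      have : Finite (M ⧸ N) := hf
      intro x
      refine ⟨⟨(Nat.card (M ⧸ N) : ℤ_[p]), mem_nonZeroDivisors_of_ne_zero ?_⟩, ?_⟩
      · exact_mod_cast Nat.card_pos.ne'
      · change (Nat.card (M ⧸ N) : ℤ_[p]) • x = 0
        rw [Nat.cast_smul_eq_nsmul, card_nsmul_eq_zero']
    omega
  have hle : D p M (om p (n + 1)) ≤ D p M (om p n) := by
    intro x hx
    obtain ⟨y, hy, rfl⟩ := (hsucc x).1 hx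
    exact N.smul_mem _ hy
  have key := AddSubgroup.relIndex_mul_index
    (H := (D p M (om p (n + 1))).toAddSubgroup) (K := (D p M (om p n)).toAddSubgroup) hle
  have hr : (D p M (om p (n + 1))).toAddSubgroup.relIndex (D p M (om p n)).toAddSubgroup
      = p ^ Module.finrank ℤ_[p] N := by
    refine relIndex_p p N (((D p M (om p (n + 1))).toAddSubgroup).addSubgroupOf
      (D p M (om p n)).toAddSubgroup) ?_
    rintro ⟨x, hx⟩
    change x ∈ D p M (om p (n + 1)) ↔ _
    refine (hsucc x).trans ⟨?_, ?_⟩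
    · rintro ⟨y, hy, h⟩; exact ⟨⟨y, hy⟩, Subtype.ext h⟩
    · rintro ⟨⟨y, hy⟩, h⟩; exact ⟨y, hy, congrArg Subtype.val h⟩
  rw [hr, hfr] at key
  exact key.symm

end Iw


/-- Exact Iwasawa growth formula with `μ = 0`: let `Λ = ℤ_p⟦T⟧` and `M` a finitely
generated torsion `Λ`-module that is finitely generated over `ℤ_p`, of `ℤ_p`-rank `λ`.
If `M/ω_n M` is finite for all `n`, where `ω_n = (1+T)^{p^n} - 1`, then there exist
`n₀` and `ν` with `ord_p #(M/ω_n M) = λ·n + ν` for all `n ≥ n₀`. -/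
theorem stmt11 (p : ℕ) [Fact p.Prime] (M : Type) [AddCommGroup M]
    [Module (PowerSeries ℤ_[p]) M] [Module ℤ_[p] M]
    [IsScalarTower ℤ_[p] (PowerSeries ℤ_[p]) M]
    [Module.Finite (PowerSeries ℤ_[p]) M] [Module.Finite ℤ_[p] M]
    (htor : Module.IsTorsion (PowerSeries ℤ_[p]) M)
    (hfin : ∀ n : ℕ, Finite (M ⧸ LinearMap.range
      ((((1 + PowerSeries.X : PowerSeries ℤ_[p]) ^ (p ^ n) - 1 : PowerSeries ℤ_[p])) •
        (LinearMap.id : M →ₗ[PowerSeries ℤ_[p]] M)))) :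
    ∃ (n₀ : ℕ) (ν : ℤ), ∀ n : ℕ, n₀ ≤ n →
      ((Nat.card (M ⧸ LinearMap.range
          ((((1 + PowerSeries.X : PowerSeries ℤ_[p]) ^ (p ^ n) - 1 : PowerSeries ℤ_[p])) •
            (LinearMap.id : M →ₗ[PowerSeries ℤ_[p]] M)))).factorization p : ℤ)
        = (Module.finrank ℤ_[p] (M ⧸ Submodule.torsion ℤ_[p] M) : ℤ) * n + ν := by
  obtain ⟨s, hs⟩ := Iw.exists_s p M
  obtain ⟨k, hk⟩ := Iw.exists_k p M (s + 2)
  have step : ∀ n, k ≤ n → _ := fun n hn => Iw.card_succ p M n (s + 2) (by omega)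
    (fun x hx => by rw [pow_add, mul_comm, mul_smul, hs x hx, smul_zero]) (hk n hn) (hfin n)
  have hpp : p.Prime := Fact.out
  set l := Module.finrank ℤ_[p] (M ⧸ Submodule.torsion ℤ_[p] M)
  refine ⟨k, ((Nat.card (M ⧸ Iw.D p M (Iw.om p k))).factorization p : ℤ) - l * k, ?_⟩
  intro n hn
  induction n, hn using Nat.le_induction with
  | base => ring
  | succ n hn ih =>
    have h1 := step n hn
    have h2 : Nat.card (M ⧸ Iw.D p M (Iw.om p n)) ≠ 0 := by
      have := hfin n
      exact Nat.card_pos.ne'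
    have h3 : (Nat.card (M ⧸ Iw.D p M (Iw.om p (n + 1)))).factorization p =
        l + (Nat.card (M ⧸ Iw.D p M (Iw.om p n))).factorization p := by
      rw [h1, Nat.factorization_mul (pow_ne_zero _ hpp.ne_zero) h2, Finsupp.add_apply,
        hpp.factorization_pow, Finsupp.single_eq_same]
    change ((Nat.card (M ⧸ Iw.D p M (Iw.om p (n + 1)))).factorization p : ℤ) = _
    change ((Nat.card (M ⧸ Iw.D p M (Iw.om p n))).factorization p : ℤ) = _ at ih
    rw [h3]
    push_cast
    rw [ih]; ring
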